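/- arXiv:2010.01756 — 2 statements merged into one kernel-verified Lean document; each statement's English description precedes it below -/
import Mathlib

section
/- Restriction of the proportion chain (p = 1/2): for any fixed constants r_0 > 0 and γ > 0 there exist constants C, c > 0 such that for all sufficiently large n and all r > max{3r_0, 2}, setting t = ⌈γn⌉, ρ_0 = r_0/√n and ρ = r/√n, the bound ℙ_{σ_0}( ∃ u with 0 ≤ u ≤ t and S_u ∉ S_n^{ρ+} ) ≤ C e^{−c r²} holds for every initial configuration σ_0 with S_0 ∈ S_n^{ρ_0+}. -/
open Finset
open scoped Classical

/-- Configuration space `Σ_n = {1,2,3}^{V_n}`, colors encoded as `Fin 3`. -/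
abbrev Config (n : ℕ) := Fin n → Fin 3

/-- Transition matrix of the cyclic dynamics with parameter `p` on `Σ_n`. -/
noncomputable def cyclicP (n : ℕ) (p : ℝ) : Matrix (Config n) (Config n) ℝ :=
  Matrix.of fun σ τ => (1 / (n : ℝ)) * ∑ v : Fin n,
    ((1 - p) * (if τ = σ then (1 : ℝ) else 0)
      + p * (if τ = Function.update σ v (σ v + 1) then (1 : ℝ) else 0))

/-- Proportion vector `S(σ) ∈ ℝ³`. -/
noncomputable def propVec {n : ℕ} (σ : Config n) : Fin 3 → ℝ :=
  fun k => ((univ.filter fun v => σ v = k).card : ℝ) / n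

/-- Membership in `S_n^{ρ+} = {s ∈ S ∩ (1/n)ℤ³ : s^k < 1/3 + ρ for all k}`. -/
def inSnPlus (n : ℕ) (ρ : ℝ) (s : Fin 3 → ℝ) : Prop :=
  (∀ k, 0 ≤ s k) ∧ (∑ k, s k) = 1 ∧ (∀ k, ∃ a : ℕ, s k = (a : ℝ) / n) ∧
    (∀ k, s k < 1/3 + ρ)

/-- Transition matrix of the cyclic dynamics (with `p = 1/2`) killed upon exiting
`{σ : S(σ) ∈ S_n^{ρ+}}`; the total mass of its `t`-th power row is the probability
that the proportion chain stays in `S_n^{ρ+}` during the first `t` steps. -/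
noncomputable def killedP (n : ℕ) (ρ : ℝ) : Matrix (Config n) (Config n) ℝ :=
  Matrix.of fun σ τ =>
    if inSnPlus n ρ (propVec τ) then cyclicP n (1/2) σ τ else 0

/-- A sum over vertices of a function of the color is a sum over colors weighted by the
proportions. -/
lemma sum_comp_color {n : ℕ} (hn : 0 < n) (σ : Config n) (F : Fin 3 → ℝ) :
    ∑ v, F (σ v) = n * ∑ k, propVec σ k * F k := by
  have hn' : (n : ℝ) ≠ 0 := by positivity
  rw [← Finset.sum_fiberwise univ σ (fun v => F (σ v)), Finset.mul_sum]
  refine Finset.sum_congr rfl fun k _ => ?_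
  rw [Finset.sum_congr rfl (g := fun _ => F k) (fun v hv => by rw [(Finset.mem_filter.1 hv).2])]
  rw [Finset.sum_const, nsmul_eq_mul, propVec]
  field_simp

lemma propVec_nonneg {n : ℕ} (σ : Config n) (k : Fin 3) : 0 ≤ propVec σ k := by
  unfold propVec
  positivity

lemma sum_propVec {n : ℕ} (hn : 0 < n) (σ : Config n) : ∑ k, propVec σ k = 1 := by
  have hn' : (n : ℝ) ≠ 0 := by positivity
  have h := sum_comp_color hn σ (fun _ => 1)
  simp only [mul_one, Finset.sum_const, Finset.card_univ, Fintype.card_fin, nsmul_eq_mul] at h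
  exact mul_left_cancel₀ hn' (by rw [mul_one]; exact h.symm)

lemma propVec_update {n : ℕ} (σ : Config n) (v : Fin n) (c k : Fin 3) :
    propVec (Function.update σ v c) k =
      propVec σ k + ((if c = k then 1 else 0) - (if σ v = k then 1 else 0)) / n := by
  have key (τ : Config n) : propVec τ k =
      ((if τ v = k then 1 else 0) + ∑ w ∈ univ.erase v, if τ w = k then (1 : ℝ) else 0) / n := by
    rw [Finset.add_sum_erase univ (fun w => if τ w = k then (1 : ℝ) else 0) (mem_univ v)]
    simp [propVec]
  have hsum : ∑ w ∈ univ.erase v, (if Function.update σ v c w = k then (1 : ℝ) else 0) =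
      ∑ w ∈ univ.erase v, if σ w = k then (1 : ℝ) else 0 :=
    Finset.sum_congr rfl fun w hw => by
      rw [Function.update_of_ne (Finset.ne_of_mem_erase hw)]
  rw [key, key σ, hsum, Function.update_self]
  ring

/-- The squared Euclidean distance of the proportion vector to `(1/3, 1/3, 1/3)`. -/
noncomputable def energy {n : ℕ} (σ : Config n) : ℝ :=
  (∑ k, propVec σ k ^ 2) - 1 / 3

lemma energy_update {n : ℕ} (σ : Config n) (v : Fin n) :
    energy (Function.update σ v (σ v + 1)) =
      energy σ + 2 / n * (propVec σ (σ v + 1) - propVec σ (σ v)) + 2 / n ^ 2 := by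
  simp only [energy, propVec_update, Fin.sum_univ_three]
  generalize σ v = k
  fin_cases k <;> simp <;> ring

/-- The exponential of the scaled energy, a Lyapunov function of the cyclic dynamics. -/
noncomputable def lyapunov {n : ℕ} (σ : Config n) : ℝ :=
  Real.exp (n / 4 * energy σ)

lemma cyclicP_nonneg (n : ℕ) (σ τ : Config n) : 0 ≤ cyclicP n (1 / 2) σ τ := by
  simp only [cyclicP, Matrix.of_apply]
  refine mul_nonneg (by positivity) (Finset.sum_nonneg fun v _ => ?_)
  split_ifs <;> norm_num

lemma sum_cyclicP_mul (n : ℕ) (σ : Config n) (f : Config n → ℝ) :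
    ∑ τ, cyclicP n (1 / 2) σ τ * f τ =
      1 / n * ∑ v, (1 / 2 * f σ + 1 / 2 * f (Function.update σ v (σ v + 1))) := by
  simp only [cyclicP, Matrix.of_apply, mul_assoc, ← Finset.mul_sum, Finset.sum_mul]
  rw [Finset.sum_comm]
  congr 1
  refine Finset.sum_congr rfl fun v _ => ?_
  simp only [add_mul, Finset.sum_add_distrib, mul_assoc, ← Finset.mul_sum, ite_mul, one_mul,
    zero_mul, Finset.sum_ite_eq', mem_univ, if_true]
  norm_num

lemma sum_cyclicP {n : ℕ} (hn : 0 < n) (σ : Config n) : ∑ τ, cyclicP n (1 / 2) σ τ = 1 := by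
  have hn' : (n : ℝ) ≠ 0 := by positivity
  have h := sum_cyclicP_mul n σ (fun _ => 1)
  simp only [mul_one] at h
  rw [h]
  norm_num [hn']

lemma exp_half_le {d : ℝ} (h₁ : -1 ≤ d) (h₂ : d ≤ 1) :
    Real.exp (d / 2) ≤ 1 + d / 2 + d ^ 2 / 4 := by
  have h := Real.abs_exp_sub_one_sub_id_le (x := d / 2) (abs_le.2 ⟨by linarith, by linarith⟩)
  have := (abs_le.1 h).2
  nlinarith

/-- The exponential moment of the linear part of an energy increment is at most one. -/
lemma sum_mul_exp_le_one {a b c : ℝ} (ha : 0 ≤ a) (hb : 0 ≤ b) (hc : 0 ≤ c)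
    (h : a + b + c = 1) :
    a * Real.exp ((b - a) / 2) + b * Real.exp ((c - b) / 2) + c * Real.exp ((a - c) / 2) ≤ 1 := by
  have h₁ := mul_le_mul_of_nonneg_left
    (exp_half_le (d := b - a) (by linarith) (by linarith)) ha
  have h₂ := mul_le_mul_of_nonneg_left
    (exp_half_le (d := c - b) (by linarith) (by linarith)) hb
  have h₃ := mul_le_mul_of_nonneg_left
    (exp_half_le (d := a - c) (by linarith) (by linarith)) hc
  have e₁ := mul_le_mul_of_nonneg_right (show a ≤ 1 by linarith) (sq_nonneg (b - a))
  have e₂ := mul_le_mul_of_nonneg_right (show b ≤ 1 by linarith) (sq_nonneg (c - b))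
  have e₃ := mul_le_mul_of_nonneg_right (show c ≤ 1 by linarith) (sq_nonneg (a - c))
  linarith

lemma sum_cyclicP_mul_lyapunov_le {n : ℕ} (hn : 0 < n) (σ : Config n) :
    ∑ τ, cyclicP n (1 / 2) σ τ * lyapunov τ ≤ Real.exp (1 / (2 * n)) * lyapunov σ := by
  have hn' : (n : ℝ) ≠ 0 := by positivity
  have hstep (v : Fin n) : lyapunov (Function.update σ v (σ v + 1)) =
      lyapunov σ * Real.exp (1 / (2 * n)) *
        Real.exp ((propVec σ (σ v + 1) - propVec σ (σ v)) / 2) := by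
    rw [lyapunov, energy_update, lyapunov, ← Real.exp_add, ← Real.exp_add]
    congr 1
    field_simp
    ring
  have hexp : (∑ k, propVec σ k * Real.exp ((propVec σ (k + 1) - propVec σ k) / 2)) ≤ 1 := by
    have hsum := sum_propVec hn σ
    rw [Fin.sum_univ_three] at hsum ⊢
    exact sum_mul_exp_le_one (propVec_nonneg σ 0) (propVec_nonneg σ 1) (propVec_nonneg σ 2) hsum
  have hone : 1 ≤ Real.exp (1 / (2 * n : ℝ)) := Real.one_le_exp (by positivity)
  have hpos : 0 < lyapunov σ := Real.exp_pos _
  rw [sum_cyclicP_mul]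
  simp only [hstep, Finset.sum_add_distrib, ← Finset.mul_sum]
  rw [sum_comp_color hn σ (fun k => Real.exp ((propVec σ (k + 1) - propVec σ k) / 2))]
  simp only [Finset.sum_const, Finset.card_univ, Fintype.card_fin, nsmul_eq_mul]
  generalize (∑ k, propVec σ k * Real.exp ((propVec σ (k + 1) - propVec σ k) / 2)) = m at *
  calc _ = 1 / 2 * (lyapunov σ * 1) + 1 / 2 * (lyapunov σ * Real.exp (1 / (2 * n)) * m) := by
        field_simp
    _ ≤ 1 / 2 * (lyapunov σ * Real.exp (1 / (2 * n))) +
          1 / 2 * (lyapunov σ * Real.exp (1 / (2 * n)) * 1) := by gcongr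
    _ = _ := by ring

lemma le_energy_of_not_inSnPlus {n : ℕ} (hn : 0 < n) {ρ : ℝ} (hρ : 0 ≤ ρ) {σ : Config n}
    (h : ¬ inSnPlus n ρ (propVec σ)) : 3 / 2 * ρ ^ 2 ≤ energy σ := by
  have hsum := sum_propVec hn σ
  have hk : ∃ k, 1 / 3 + ρ ≤ propVec σ k := by
    by_contra! hlt
    exact h ⟨propVec_nonneg σ, hsum, fun k => ⟨_, rfl⟩, hlt⟩
  obtain ⟨k, hk⟩ := hk
  rw [energy]
  rw [Fin.sum_univ_three] at hsum ⊢
  have hsq : ρ ^ 2 ≤ (propVec σ k - 1 / 3) ^ 2 := by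
    gcongr
    linarith
  generalize propVec σ = s at *
  obtain rfl | rfl | rfl : k = 0 ∨ k = 1 ∨ k = 2 := by fin_cases k <;> simp
  · have h0 : s 0 = 1 - s 1 - s 2 := by linarith
    nlinarith [sq_nonneg (s 1 - s 2)]
  · have h0 : s 1 = 1 - s 0 - s 2 := by linarith
    nlinarith [sq_nonneg (s 0 - s 2)]
  · have h0 : s 2 = 1 - s 0 - s 1 := by linarith
    nlinarith [sq_nonneg (s 0 - s 1)]

lemma energy_le_of_inSnPlus {n : ℕ} {ρ : ℝ} {σ : Config n}
    (h : inSnPlus n ρ (propVec σ)) : energy σ ≤ 6 * ρ ^ 2 := by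
  obtain ⟨-, hsum, -, hlt⟩ := h
  rw [energy]
  rw [Fin.sum_univ_three] at hsum ⊢
  have h0 := hlt 0
  have h1 := hlt 1
  have h2 := hlt 2
  generalize propVec σ = s at *
  have h3 : s 2 = 1 - s 0 - s 1 := by linarith
  rw [h3] at h2 ⊢
  nlinarith [mul_nonneg (sub_nonneg.2 h0.le) (sub_nonneg.2 h1.le),
    mul_nonneg (sub_nonneg.2 h0.le) (sub_nonneg.2 h2.le),
    mul_nonneg (sub_nonneg.2 h1.le) (sub_nonneg.2 h2.le)]

/-- A multiplicative drift condition for a nonnegative function that is at least `1` outside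
`S_n^{ρ+}` bounds the exit probability. -/
lemma exit_probability_le {n : ℕ} (hn : 0 < n) (ρ a : ℝ) (ha : 1 ≤ a) (f : Config n → ℝ)
    (hf : ∀ σ, 0 ≤ f σ) (hbad : ∀ σ, ¬ inSnPlus n ρ (propVec σ) → 1 ≤ f σ)
    (hdrift : ∀ σ, ∑ τ, cyclicP n (1 / 2) σ τ * f τ ≤ a * f σ) (t : ℕ) (σ : Config n) :
    1 - ∑ τ, (killedP n ρ ^ t) σ τ ≤ a ^ t * f σ := by
  induction t generalizing σ with
  | zero => simpa [Matrix.one_apply] using hf σ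
  | succ t ih =>
    have hrow : ∑ τ, (killedP n ρ ^ (t + 1)) σ τ =
        ∑ η, killedP n ρ σ η * ∑ τ, (killedP n ρ ^ t) η τ := by
      simp only [pow_succ', Matrix.mul_apply, Finset.mul_sum]
      exact Finset.sum_comm
    rw [hrow, ← sum_cyclicP hn σ, ← Finset.sum_sub_distrib]
    calc _ ≤ ∑ η, cyclicP n (1 / 2) σ η * (a ^ t * f η) := by
          refine Finset.sum_le_sum fun η _ => ?_
          have hP := cyclicP_nonneg n σ η
          simp only [killedP, Matrix.of_apply]
          split_ifs with hη
          · have := mul_le_mul_of_nonneg_left (ih η) hP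
            simp only [killedP] at this
            linarith
          · have h1 : 1 ≤ a ^ t * f η := one_le_mul_of_one_le_of_one_le (one_le_pow₀ ha) (hbad η hη)
            nlinarith
      _ = a ^ t * ∑ η, cyclicP n (1 / 2) σ η * f η := by
          rw [Finset.mul_sum]
          exact Finset.sum_congr rfl fun η _ => by ring
      _ ≤ a ^ t * (a * f σ) := by
          have := hdrift σ
          gcongr
      _ = a ^ (t + 1) * f σ := by ring

/-- restriction of the proportion chain. For fixed `r₀, γ > 0` there
are `C, c > 0` such that for all large `n` and all `r > max{3r₀, 2}`, starting from any
`σ0` with `S_0 ∈ S_n^{ρ₀+}` (`ρ₀ = r₀/√n`, `ρ = r/√n`), the probability that the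
proportion chain exits `S_n^{ρ+}` within time `t = γn` is at most `C e^{−c r²}`. -/
theorem proportion_chain_restriction (r0 γ : ℝ) (hr0 : 0 < r0) (hγ : 0 < γ) :
    ∃ C c : ℝ, 0 < C ∧ 0 < c ∧ ∃ N : ℕ, ∀ n : ℕ, N ≤ n →
      ∀ r : ℝ, max (3 * r0) 2 < r →
        ∀ σ0 : Config n, inSnPlus n (r0 / Real.sqrt n) (propVec σ0) →
          1 - (∑ τ : Config n, ((killedP n (r / Real.sqrt n)) ^ ⌈γ * n⌉₊) σ0 τ)
            ≤ C * Real.exp (-c * r ^ 2) := by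
  refine ⟨Real.exp (γ / 2 + 1 / 2), 1 / 8, Real.exp_pos _, by norm_num, 1, ?_⟩
  intro n hn r hr σ0 hσ0
  have hn0 : 0 < n := hn
  have hnR : (1 : ℝ) ≤ n := by exact_mod_cast hn
  have hr1 : 3 * r0 < r := (le_max_left _ _).trans_lt hr
  have hρsq (x : ℝ) : (n : ℝ) * (x / Real.sqrt n) ^ 2 = x ^ 2 := by
    rw [div_pow, Real.sq_sqrt (by positivity)]
    field_simp
  have hexit := exit_probability_le hn0 (r / Real.sqrt n) (Real.exp (1 / (2 * n)))
    (Real.one_le_exp (by positivity))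
    (fun σ => Real.exp (-(3 / 8 * r ^ 2)) * lyapunov σ)
    (fun σ => by unfold lyapunov; positivity)
    (fun σ hσ => by
      have hE := le_energy_of_not_inSnPlus hn0 (div_nonneg (by linarith) (by positivity)) hσ
      have hnE := mul_le_mul_of_nonneg_left hE (Nat.cast_nonneg (α := ℝ) n)
      rw [lyapunov, ← Real.exp_add]
      exact Real.one_le_exp (by linarith [hρsq r]))
    (fun σ => by
      have h := mul_le_mul_of_nonneg_left (sum_cyclicP_mul_lyapunov_le hn0 σ)
        (Real.exp_pos (-(3 / 8 * r ^ 2))).le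
      rw [Finset.mul_sum] at h
      simpa only [mul_left_comm] using h)
    ⌈γ * n⌉₊ σ0
  refine hexit.trans ?_
  have hE := mul_le_mul_of_nonneg_left (energy_le_of_inSnPlus hσ0) (Nat.cast_nonneg (α := ℝ) n)
  have htime : (⌈γ * n⌉₊ : ℝ) * (1 / (2 * n)) ≤ γ / 2 + 1 / 2 := by
    have hceil := (Nat.ceil_lt_add_one (show 0 ≤ γ * n by positivity)).le
    rw [mul_one_div, div_le_iff₀ (by positivity)]
    nlinarith
  rw [lyapunov, ← Real.exp_nat_mul, ← Real.exp_add, ← Real.exp_add, ← Real.exp_add,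
    Real.exp_le_exp]
  nlinarith [hρsq r0]
end

section
/- There exists a Markovian coupling ((σ_t, σ̃_t)) of two copies of the cyclic dynamics with p = 1/2 (the semi-coordinatewise coupling) with the following property: for any t ≥ 0, on the event that ‖S_t − S̃_t‖_1 ≥ 10/n, the conditional expected one-step change satisfies E[ ‖S_{t+1} − S̃_{t+1}‖_1 − ‖S_t − S̃_t‖_1 | F_t ] ≤ 0, where (S_t) and (S̃_t) are the two proportion chains and (F_t) is the natural filtration of the pair. -/
open Finset

/-- ℓ¹ norm on `ℝ³`. -/
def l1 (x : Fin 3 → ℝ) : ℝ := ∑ k, |x k|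

/-- A Markovian coupling of two copies of the cyclic dynamics: a transition matrix on
`Σ_n × Σ_n` with nonnegative entries whose marginal transitions are both `cyclicP n p`. -/
def IsCoupling (n : ℕ) (p : ℝ) (K : Matrix (Config n × Config n) (Config n × Config n) ℝ) : Prop :=
  (∀ x y, 0 ≤ K x y) ∧
  (∀ x : Config n × Config n, ∀ τ : Config n,
      ∑ τ' : Config n, K x (τ, τ') = cyclicP n p x.1 τ) ∧
  (∀ x : Config n × Config n, ∀ τ' : Config n,
      ∑ τ : Config n, K x (τ, τ') = cyclicP n p x.2 τ')

/-- The configuration obtained from `σ` by advancing the color of `v`. -/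
def advance {n : ℕ} (σ : Config n) (v : Fin n) : Config n :=
  Function.update σ v (σ v + 1)

/-- The number of vertices of color `k`. -/
def colorCount {n : ℕ} (σ : Config n) (k : Fin 3) : ℕ :=
  (univ.filter fun v => σ v = k).card

lemma colorCount_eq_sum {n : ℕ} (σ : Config n) (k : Fin 3) :
    (colorCount σ k : ℝ) = ∑ v, if σ v = k then (1 : ℝ) else 0 := by
  simp [colorCount]

lemma colorCount_advance {n : ℕ} (σ : Config n) (v : Fin n) (k : Fin 3) :
    (colorCount (advance σ v) k : ℝ) = colorCount σ k
      + ((if σ v + 1 = k then (1 : ℝ) else 0) - if σ v = k then (1 : ℝ) else 0) := by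
  rw [colorCount_eq_sum, colorCount_eq_sum, ← sub_eq_iff_eq_add', ← sum_sub_distrib,
    sum_eq_single v]
  · simp [advance]
  · intro w _ hw
    simp [advance, hw]
  · simp

lemma propVec_advance {n : ℕ} (σ : Config n) (v : Fin n) (k : Fin 3) :
    propVec (advance σ v) k = propVec σ k
      + (1 / (n : ℝ)) * ((if σ v + 1 = k then (1 : ℝ) else 0) - if σ v = k then (1 : ℝ) else 0) := by
  have h := colorCount_advance σ v k
  simp only [colorCount] at h
  rw [propVec, propVec, h]
  ring

lemma l1_sub_comm (x y : Fin 3 → ℝ) : l1 (x - y) = l1 (y - x) := by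
  simp [l1, abs_sub_comm]

/-- Moving mass `c ≤ x i` out of a coordinate does not increase the `ℓ¹` norm. -/
lemma l1_add_transfer_le {x y : Fin 3 → ℝ} {c : ℝ} (i : Fin 3) (hc : 0 ≤ c) (hx : c ≤ x i)
    (hy : ∀ k, y k = x k
      + c * ((if i + 1 = k then (1 : ℝ) else 0) - if i = k then (1 : ℝ) else 0)) :
    l1 y ≤ l1 x := by
  have step : ∀ a b : ℝ, c ≤ a → |a - c| + |b + c| ≤ |a| + |b| := by
    intro a b ha
    have := abs_add_le b c
    rw [abs_of_nonneg (sub_nonneg.2 ha), abs_of_nonneg (hc.trans ha)]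
    rw [abs_of_nonneg hc] at this
    linarith
  have h0 := hy 0
  have h1 := hy 1
  have h2 := hy 2
  simp only [l1, Fin.sum_univ_three, h0, h1, h2]
  fin_cases i
  · have := step (x 0) (x 1) hx
    simp [← sub_eq_add_neg]
    linarith
  · have := step (x 1) (x 2) hx
    simp [← sub_eq_add_neg]
    linarith
  · have := step (x 2) (x 0) hx
    simp [← sub_eq_add_neg]
    linarith

lemma l1_advance_le {n : ℕ} (σ σ' : Config n) (v : Fin n)
    (h : colorCount σ' (σ v) < colorCount σ (σ v)) :
    l1 (propVec (advance σ v) - propVec σ') ≤ l1 (propVec σ - propVec σ') := by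
  refine l1_add_transfer_le (c := 1 / (n : ℝ)) (σ v) (by positivity) ?_ fun k => ?_
  · have h' : (colorCount σ' (σ v) : ℝ) + 1 ≤ colorCount σ (σ v) := by exact_mod_cast h
    simp only [colorCount] at h'
    rw [Pi.sub_apply, propVec, propVec, ← sub_div]
    gcongr
    linarith
  · simp only [Pi.sub_apply, propVec_advance]
    ring

lemma propVec_advance_sub {n : ℕ} (σ σ' : Config n) (v w : Fin n) (h : σ' w = σ v) :
    propVec (advance σ v) - propVec (advance σ' w) = propVec σ - propVec σ' := by
  ext k
  simp only [Pi.sub_apply, propVec_advance, h]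
  ring

lemma exists_match_of_colorCount_le {n : ℕ} {f g : Config n} {v : Fin n} (hv : g v ≠ f v)
    (h : colorCount f (f v) ≤ colorCount g (f v)) : ∃ w, g w = f v ∧ f w ≠ f v := by
  by_contra! H
  refine absurd h (not_le.2 (card_lt_card ?_))
  rw [ssubset_iff_of_subset]
  · exact ⟨v, by simp, by simpa using hv⟩
  · intro w hw
    simp only [mem_filter, mem_univ, true_and] at hw ⊢
    exact H w hw

lemma card_matches_lt_swap {n : ℕ} {f g : Config n} {v w : Fin n} (hv : g v ≠ f v)
    (hw : g w ≠ f w) (h : g w = f v) :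
    (univ.filter fun u => g u = f u).card
      < (univ.filter fun u => g (Equiv.swap v w u) = f u).card := by
  refine card_lt_card ((ssubset_iff_of_subset ?_).2 ⟨v, by simpa using h, by simpa using hv⟩)
  intro u hu
  simp only [mem_filter, mem_univ, true_and] at hu ⊢
  have huv : u ≠ v := by rintro rfl; exact hv hu
  have huw : u ≠ w := by rintro rfl; exact hw hu
  rwa [Equiv.swap_apply_of_ne_of_ne huv huw]

lemma colorCount_comp_perm {n : ℕ} (σ : Config n) (π : Equiv.Perm (Fin n)) (k : Fin 3) :
    colorCount (σ ∘ π) k = colorCount σ k := by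
  rw [← Nat.cast_inj (R := ℝ), colorCount_eq_sum, colorCount_eq_sum]
  exact Equiv.sum_comp π fun v => if σ v = k then (1 : ℝ) else 0

/-- A pairing of the vertices with the largest number of color agreements pairs a vertex whose
color is in excess in `σ` with one whose color is in excess in `σ'` wherever the colors differ. -/
lemma exists_perm_matching {n : ℕ} (σ σ' : Config n) :
    ∃ π : Equiv.Perm (Fin n), ∀ v, σ' (π v) ≠ σ v →
      colorCount σ' (σ v) < colorCount σ (σ v) ∧
      colorCount σ (σ' (π v)) < colorCount σ' (σ' (π v)) := by
  obtain ⟨π, hπ⟩ := Finite.exists_max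
    fun π : Equiv.Perm (Fin n) => (univ.filter fun u => σ' (π u) = σ u).card
  have no_swap : ∀ v w, σ' (π v) ≠ σ v → σ' (π w) ≠ σ w → σ' (π w) ≠ σ v := by
    intro v w hv hw h
    exact absurd (card_matches_lt_swap (f := σ) (g := σ' ∘ π) hv hw h)
      (not_lt.2 (hπ ((Equiv.swap v w).trans π)))
  refine ⟨π, fun v hv => ⟨?_, ?_⟩⟩ <;> by_contra! h
  · rw [← colorCount_comp_perm σ' π] at h
    obtain ⟨w, hw, hw'⟩ := exists_match_of_colorCount_le (f := σ) (g := σ' ∘ π) hv h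
    exact no_swap v w hv (fun e => hw' (e.symm.trans hw)) hw
  · rw [← colorCount_comp_perm σ' π] at h
    obtain ⟨w, hw, hw'⟩ := exists_match_of_colorCount_le (f := σ' ∘ π) (g := σ) hv.symm h
    exact no_swap w v (fun e => hw' (e.trans hw)) hv hw.symm

/-- The outcome of the coupling when the first copy advances `v`: the second copy advances `w`
exactly if the colors agree. -/
def firstMoves {n : ℕ} (x : Config n × Config n) (v w : Fin n) : Config n × Config n :=
  (advance x.1 v, if x.2 w = x.1 v then advance x.2 w else x.2)

/-- The outcome of the coupling when the first copy stays at `v`: the second copy advances `w`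
exactly if the colors differ. -/
def firstStays {n : ℕ} (x : Config n × Config n) (v w : Fin n) : Config n × Config n :=
  (x.1, if x.2 w = x.1 v then x.2 else advance x.2 w)

/-- The coupling in which the first copy chooses `v`, the second chooses `π x v`, and the two
updates use the same coin if the colors agree and opposite coins otherwise. -/
noncomputable def pairedCoupling (n : ℕ) (π : Config n × Config n → Equiv.Perm (Fin n)) :
    Matrix (Config n × Config n) (Config n × Config n) ℝ :=
  Matrix.of fun x y => (1 / (n : ℝ)) * ∑ v : Fin n,
    ((1 / 2) * (if y = firstStays x v (π x v) then (1 : ℝ) else 0)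
      + (1 / 2) * (if y = firstMoves x v (π x v) then (1 : ℝ) else 0))

lemma sum_pairedCoupling_mul {n : ℕ} (π : Config n × Config n → Equiv.Perm (Fin n))
    (x : Config n × Config n) (f : Config n × Config n → ℝ) :
    ∑ y, pairedCoupling n π x y * f y = (1 / (n : ℝ)) * ∑ v : Fin n,
      ((1 / 2) * f (firstStays x v (π x v)) + (1 / 2) * f (firstMoves x v (π x v))) := by
  simp only [pairedCoupling, Matrix.of_apply, mul_assoc, ← mul_sum, sum_mul]
  rw [sum_comm]
  simp [add_mul, sum_add_distrib, ← mul_sum]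

lemma isCoupling_pairedCoupling (n : ℕ) (π : Config n × Config n → Equiv.Perm (Fin n)) :
    IsCoupling n (1 / 2) (pairedCoupling n π) := by
  refine ⟨fun x y => ?_, fun x τ => ?_, fun x τ' => ?_⟩
  · simp only [pairedCoupling, Matrix.of_apply]
    exact mul_nonneg (by positivity) (sum_nonneg fun v _ => by split_ifs <;> norm_num)
  · have h := sum_pairedCoupling_mul π x fun y => if τ = y.1 then 1 else 0
    rw [Fintype.sum_prod_type, sum_comm] at h
    simp only [mul_ite, mul_one, mul_zero, sum_ite_eq, mem_univ, if_true] at h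
    rw [h]
    simp only [cyclicP, Matrix.of_apply, firstStays, firstMoves, advance]
    norm_num
  · have h := sum_pairedCoupling_mul π x fun y => if τ' = y.2 then 1 else 0
    rw [Fintype.sum_prod_type] at h
    simp only [mul_ite, mul_one, mul_zero, sum_ite_eq, mem_univ, if_true] at h
    rw [h]
    simp only [cyclicP, Matrix.of_apply]
    congr 1
    symm
    rw [← Equiv.sum_comp (π x)]
    refine sum_congr rfl fun v _ => ?_
    simp only [firstStays, firstMoves, advance]
    split_ifs <;> norm_num

/-- there is a Markovian coupling (the semi-coordinatewise coupling)
of two copies of the cyclic dynamics with `p = 1/2` such that whenever the current pair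
satisfies `‖S_t − S̃_t‖₁ ≥ 10/n`, the conditional expected one-step change of
`‖S − S̃‖₁` is nonpositive. -/
theorem semi_coordinatewise_coupling_supermartingale (n : ℕ) (hn : 1 ≤ n) :
    ∃ K : Matrix (Config n × Config n) (Config n × Config n) ℝ,
      IsCoupling n (1/2) K ∧
      ∀ σ σ' : Config n, 10 / (n : ℝ) ≤ l1 (propVec σ - propVec σ') →
        ∑ y : Config n × Config n,
            K (σ, σ') y * (l1 (propVec y.1 - propVec y.2) - l1 (propVec σ - propVec σ'))
          ≤ 0 := by
  choose π hπ using fun x : Config n × Config n => exists_perm_matching x.1 x.2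
  refine ⟨pairedCoupling n π, isCoupling_pairedCoupling n π, fun σ σ' _ => ?_⟩
  rw [sum_pairedCoupling_mul π (σ, σ')
    fun y => l1 (propVec y.1 - propVec y.2) - l1 (propVec σ - propVec σ')]
  refine mul_nonpos_of_nonneg_of_nonpos (by positivity) (sum_nonpos fun v _ => ?_)
  simp only [firstStays, firstMoves]
  by_cases hv : σ' (π (σ, σ') v) = σ v
  · simp [hv, propVec_advance_sub]
  · obtain ⟨h1, h2⟩ := hπ (σ, σ') v hv
    have hfirst := l1_advance_le σ σ' v h1
    have hsecond := l1_advance_le σ' σ (π (σ, σ') v) h2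
    rw [l1_sub_comm, l1_sub_comm (propVec σ')] at hsecond
    simp only [hv, if_false]
    linarith
end
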